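/- Let p be a prime, m ∈ ℕ, let h_n, h_k ∈ ℚ(p^m) with h_n ≠ h_k, let σ_m ∈ ℚ(p^m), and let δ ∈ [0, p^{−m}). Then h_n ⊕_p (σ_m + δ) < h_k ⊕_p (σ_m + δ) holds if and only if h_n ⊕_{p,m}^{simp} σ_m < h_k ⊕_{p,m}^{simp} σ_m. -/

import Mathlib

open MeasureTheory Finset

/-- The digit of `x ∈ [0,1)` at base-`p` position `r` (the coefficient of `p^{-(r+1)}`),
using the finite expansion for `p`-adic rationals. -/
noncomputable def rdigit (p : ℕ) (x : ℝ) (r : ℕ) : ℕ :=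
  (⌊x * (p : ℝ) ^ (r + 1)⌋).toNat % p

/-- The value of the `p`-adic integer `φ_p^+(x)` modulo `p^m`, as a natural number. -/
noncomputable def truncVal (p : ℕ) (x : ℝ) (m : ℕ) : ℕ :=
  ∑ r ∈ Finset.range m, rdigit p x r * p ^ r

/-- Digit `r` of the `p`-adic sum `φ_p^+(x) +_{ℤ_p} φ_p^+(σ)`. -/
noncomputable def sdigit (p : ℕ) (x σ : ℝ) (r : ℕ) : ℕ :=
  (truncVal p x (r + 1) + truncVal p σ (r + 1)) % p ^ (r + 1) / p ^ r

/-- The `p`-adic shift `x ⊕_p σ = φ_p(φ_p^+(x) +_{ℤ_p} φ_p^+(σ))` (the Monna map applied to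
the `p`-adic sum, taken mod 1). -/
noncomputable def pshift (p : ℕ) (x σ : ℝ) : ℝ :=
  Int.fract (∑' r : ℕ, (sdigit p x σ r : ℝ) / (p : ℝ) ^ (r + 1))

/-- The simplified `p`-adic shift `x ⊕_{p,m}^{simp} σ`: the truncation of `x ⊕_p σ` to its `m`
most significant base-`p` digits. -/
noncomputable def simpShift (p m : ℕ) (x σ : ℝ) : ℝ :=
  ∑ r ∈ Finset.range m, (sdigit p x σ r : ℝ) / (p : ℝ) ^ (r + 1)

/-- The mid-simplified `p`-adic shift `x ⊕_{p,m}^{simi} σ = (x ⊕_{p,m}^{simp} σ) + 1/(2p^m)`. -/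
noncomputable def midShift (p m : ℕ) (x σ : ℝ) : ℝ :=
  simpShift p m x σ + 1 / (2 * (p : ℝ) ^ m)

/-- The radical inverse function `φ_p(n) = Σ_r n_r p^{-(r+1)}` in base `p`. -/
noncomputable def radInv (p n : ℕ) : ℝ :=
  ∑' r : ℕ, ((n / p ^ r % p : ℕ) : ℝ) / (p : ℝ) ^ (r + 1)

/-- Membership in `ℚ(p^m) = {a p^{-m} : a = 0,1,…,p^m - 1}`. -/
def QSet (p m : ℕ) (x : ℝ) : Prop :=
  ∃ a : ℕ, a < p ^ m ∧ x = (a : ℝ) / (p : ℝ) ^ m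

/-- The squared worst-case error of the QMC rule based on the `N`-element point set
`P ⊆ [0,1)^d` in the weighted anchored Sobolev space with weights `γ` (0-indexed, so the
paper's `γ_j` is `γ (j-1)`). -/
noncomputable def sqErr (d N : ℕ) (γ : ℕ → ℝ) (P : Fin N → Fin d → ℝ) : ℝ :=
  (∏ j : Fin d, (1 + γ j.val / 3))
    - 2 / (N : ℝ) * ∑ n : Fin N, ∏ j : Fin d, (1 + γ j.val / 2 * (1 - P n j ^ 2))
    + 1 / (N : ℝ) ^ 2 *
        ∑ n : Fin N, ∑ h : Fin N, ∏ j : Fin d, (1 + γ j.val * min (1 - P n j) (1 - P h j))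

/-- The natural number whose base-`p` digits are `f 0, …, f (m - 1)`, most significant first. -/
def digitNumer (p : ℕ) (f : ℕ → ℕ) : ℕ → ℕ
  | 0 => 0
  | m + 1 => p * digitNumer p f m + f m

theorem sum_div_pow_eq_digitNumer {p : ℕ} (hp : 0 < p) (f : ℕ → ℕ) (m : ℕ) :
    ∑ r ∈ Finset.range m, (f r : ℝ) / (p : ℝ) ^ (r + 1) = digitNumer p f m / (p : ℝ) ^ m := by
  induction m with
  | zero => simp [digitNumer]
  | succ m ih =>
    have : (p : ℝ) ≠ 0 := by positivity
    rw [Finset.sum_range_succ, ih, digitNumer]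
    push_cast
    field_simp
    ring

theorem digitNumer_lt_pow {p : ℕ} {f : ℕ → ℕ} (hf : ∀ r, f r < p) (m : ℕ) :
    digitNumer p f m < p ^ m := by
  induction m with
  | zero => simp [digitNumer]
  | succ m ih =>
    rw [digitNumer, pow_succ]
    nlinarith [hf m]

theorem digitNumer_inj {p : ℕ} {f g : ℕ → ℕ} (hf : ∀ r, f r < p) (hg : ∀ r, g r < p) (m : ℕ)
    (h : digitNumer p f m = digitNumer p g m) : ∀ r < m, f r = g r := by
  induction m with
  | zero => simp
  | succ m ih =>
    simp only [digitNumer] at h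
    have hm : f m = g m := by
      have := congrArg (· % p) h
      simpa [Nat.mul_add_mod, Nat.mod_eq_of_lt (hf m), Nat.mod_eq_of_lt (hg m)] using this
    have hp : 0 < p := (Nat.zero_le _).trans_lt (hf 0)
    have hN : digitNumer p f m = digitNumer p g m := by
      rw [hm] at h
      exact Nat.eq_of_mul_eq_mul_left hp (Nat.add_right_cancel h)
    intro r hr
    rcases Nat.lt_succ_iff_lt_or_eq.mp hr with h' | rfl
    · exact ih hN r h'
    · exact hm

theorem digitNumer_congr {p : ℕ} {f g : ℕ → ℕ} (m : ℕ) (h : ∀ r < m, f r = g r) :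
    digitNumer p f m = digitNumer p g m := by
  induction m with
  | zero => rfl
  | succ m ih =>
    rw [digitNumer, digitNumer, ih fun r hr => h r (hr.trans m.lt_succ_self), h m m.lt_succ_self]

theorem rdigit_lt {p : ℕ} (hp : 0 < p) (x : ℝ) (r : ℕ) : rdigit p x r < p :=
  Nat.mod_lt _ hp

theorem floor_mul_pow_succ {p : ℕ} (hp : 0 < p) (x : ℝ) (r : ℕ) :
    ⌊x * (p : ℝ) ^ (r + 1)⌋₊ = p * ⌊x * (p : ℝ) ^ r⌋₊ + rdigit p x r := by
  have h : ⌊x * (p : ℝ) ^ r⌋₊ = ⌊x * (p : ℝ) ^ (r + 1)⌋₊ / p := by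
    rw [← Nat.floor_div_natCast]
    congr 1
    have : (p : ℝ) ≠ 0 := by positivity
    rw [pow_succ]
    field_simp
  rw [h, rdigit, Int.floor_toNat, Nat.div_add_mod]

theorem digitNumer_rdigit {p : ℕ} (hp : 0 < p) {x : ℝ} (hx : x < 1) (m : ℕ) :
    digitNumer p (rdigit p x) m = ⌊x * (p : ℝ) ^ m⌋₊ := by
  induction m with
  | zero => simp [digitNumer, Nat.floor_eq_zero.mpr hx]
  | succ m ih => rw [digitNumer, ih, floor_mul_pow_succ hp]

/-- The digits of the finite expansion are not eventually equal to `p - 1`. -/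
theorem exists_rdigit_ne {p : ℕ} (hp : 1 < p) {x : ℝ} (hx : 0 ≤ x) (R : ℕ) :
    ∃ r, R ≤ r ∧ rdigit p x r ≠ p - 1 := by
  by_contra! h
  have key : ∀ k, ⌊x * (p : ℝ) ^ (R + k)⌋₊ + 1 = p ^ k * (⌊x * (p : ℝ) ^ R⌋₊ + 1) := by
    intro k
    induction k with
    | zero => simp
    | succ k ih =>
      rw [← add_assoc, floor_mul_pow_succ (by lia), h _ (by lia), pow_succ', mul_assoc, ← ih,
        mul_add]
      lia
  have hlt := Nat.lt_floor_add_one (x * (p : ℝ) ^ R)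
  obtain ⟨k, hk⟩ := pow_unbounded_of_one_lt
    ((⌊x * (p : ℝ) ^ R⌋₊ + 1 - x * (p : ℝ) ^ R)⁻¹) (show (1 : ℝ) < p by exact_mod_cast hp)
  rw [inv_lt_iff_one_lt_mul₀ (by linarith)] at hk
  have hfl := Nat.floor_le (show 0 ≤ x * (p : ℝ) ^ (R + k) by positivity)
  have hkey : (⌊x * (p : ℝ) ^ (R + k)⌋₊ : ℝ) + 1 = p ^ k * (⌊x * (p : ℝ) ^ R⌋₊ + 1) := by
    exact_mod_cast key k
  rw [pow_add] at hfl hkey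
  nlinarith

theorem truncVal_succ (p : ℕ) (x : ℝ) (m : ℕ) :
    truncVal p x (m + 1) = truncVal p x m + rdigit p x m * p ^ m :=
  Finset.sum_range_succ _ _

theorem truncVal_lt {p : ℕ} (hp : 0 < p) (x : ℝ) (m : ℕ) : truncVal p x m < p ^ m := by
  induction m with
  | zero => simp [truncVal]
  | succ m ih =>
    rw [truncVal_succ, pow_succ]
    nlinarith [rdigit_lt hp x m]

theorem rdigit_eq_of_truncVal_eq {p : ℕ} (hp : 0 < p) {x y : ℝ} (m : ℕ)
    (h : truncVal p x m = truncVal p y m) : ∀ r < m, rdigit p x r = rdigit p y r := by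
  induction m with
  | zero => simp
  | succ m ih =>
    rw [truncVal_succ, truncVal_succ] at h
    have hT : truncVal p x m = truncVal p y m := by
      have := congrArg (· % p ^ m) h
      simpa [Nat.mod_eq_of_lt (truncVal_lt hp _ m)] using this
    have hm : rdigit p x m = rdigit p y m := by
      rw [hT] at h
      exact Nat.eq_of_mul_eq_mul_right (by positivity) (Nat.add_left_cancel h)
    intro r hr
    rcases Nat.lt_succ_iff_lt_or_eq.mp hr with h' | rfl
    · exact ih hT r h'
    · exact hm

theorem sdigit_lt {p : ℕ} (hp : 0 < p) (x σ : ℝ) (r : ℕ) : sdigit p x σ r < p := by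
  refine Nat.div_lt_of_lt_mul ?_
  rw [← pow_succ]
  exact Nat.mod_lt _ (by positivity)

/-- Schoolbook addition: digit `r` of the sum is determined by the digits of the summands at `r`
and the carry `(truncVal p x r + truncVal p σ r) / p ^ r`. -/
theorem truncVal_add_div {p : ℕ} (hp : 0 < p) (x σ : ℝ) (r : ℕ) :
    (truncVal p x (r + 1) + truncVal p σ (r + 1)) / p ^ r =
      rdigit p x r + rdigit p σ r + (truncVal p x r + truncVal p σ r) / p ^ r := by
  rw [truncVal_succ, truncVal_succ, show truncVal p x r + rdigit p x r * p ^ r +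
    (truncVal p σ r + rdigit p σ r * p ^ r) = (truncVal p x r + truncVal p σ r) +
    (rdigit p x r + rdigit p σ r) * p ^ r by ring, Nat.add_mul_div_right _ _ (by positivity)]
  ring

theorem sdigit_eq {p : ℕ} (x σ : ℝ) (r : ℕ) :
    sdigit p x σ r = (truncVal p x (r + 1) + truncVal p σ (r + 1)) / p ^ r % p := by
  rw [sdigit, pow_succ, Nat.mod_mul_right_div_self]

/-- The sum of a number with terminating expansion and an arbitrary one does not have all its
digits eventually equal to `p - 1`. -/
theorem exists_sdigit_ne {p : ℕ} (hp : 1 < p) {x σ : ℝ} (hσ : 0 ≤ σ) {m : ℕ}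
    (hx : ∀ r, m ≤ r → rdigit p x r = 0) : ∃ r, m ≤ r ∧ sdigit p x σ r ≠ p - 1 := by
  by_contra! h
  have hp0 : 0 < p := by lia
  have hstep : ∀ r, m ≤ r →
      rdigit p σ r + (truncVal p x r + truncVal p σ r) / p ^ r = p - 1 := by
    intro r hr
    have h1 := h r hr
    rw [sdigit_eq, truncVal_add_div hp0, hx r hr, zero_add] at h1
    have hc : (truncVal p x r + truncVal p σ r) / p ^ r < 2 := by
      refine Nat.div_lt_of_lt_mul ?_
      have := truncVal_lt hp0 x r
      have := truncVal_lt hp0 σ r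
      lia
    have hd := rdigit_lt hp0 σ r
    have ht : rdigit p σ r + (truncVal p x r + truncVal p σ r) / p ^ r ≤ p := by lia
    generalize rdigit p σ r + (truncVal p x r + truncVal p σ r) / p ^ r = t at h1 ht ⊢
    rcases ht.lt_or_eq with ht | rfl
    · rwa [Nat.mod_eq_of_lt ht] at h1
    · rw [Nat.mod_self] at h1
      lia
  obtain ⟨r, hr, hne⟩ := exists_rdigit_ne hp hσ (m + 1)
  obtain ⟨s, rfl⟩ : ∃ s, r = s + 1 := ⟨r - 1, by lia⟩
  have hs := hstep s (by lia)
  have hr' := hstep (s + 1) (by lia)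
  have hcarry : (truncVal p x (s + 1) + truncVal p σ (s + 1)) / p ^ (s + 1) = 0 := by
    rw [pow_succ, ← Nat.div_div_eq_div_mul, truncVal_add_div hp0, hx s (by lia), zero_add, hs]
    exact Nat.div_eq_of_lt (by lia)
  rw [hcarry] at hr'
  exact hne hr'

theorem truncVal_add_mod_succ (p : ℕ) (x σ : ℝ) (m : ℕ) :
    (truncVal p x (m + 1) + truncVal p σ (m + 1)) % p ^ (m + 1) =
      (truncVal p x m + truncVal p σ m) % p ^ m + p ^ m * sdigit p x σ m := by
  rw [sdigit_eq, pow_succ, Nat.mod_mul]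
  congr 1
  rw [truncVal_succ, truncVal_succ, show truncVal p x m + rdigit p x m * p ^ m +
    (truncVal p σ m + rdigit p σ m * p ^ m) = (truncVal p x m + truncVal p σ m) +
    (rdigit p x m + rdigit p σ m) * p ^ m by ring, Nat.add_mul_mod_self_right]

theorem truncVal_eq_of_sdigit_eq {p : ℕ} (hp : 0 < p) {x y σ : ℝ} (m : ℕ)
    (h : ∀ r < m, sdigit p x σ r = sdigit p y σ r) : truncVal p x m = truncVal p y m := by
  have hmod : truncVal p x m + truncVal p σ m ≡ truncVal p y m + truncVal p σ m [MOD p ^ m] := by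
    induction m with
    | zero => simp [Nat.ModEq, Nat.mod_one]
    | succ m ih =>
      have ih' := ih fun r hr => h r (hr.trans m.lt_succ_self)
      unfold Nat.ModEq at ih' ⊢
      rw [truncVal_add_mod_succ, truncVal_add_mod_succ, ih', h m m.lt_succ_self]
  exact (Nat.ModEq.add_right_cancel' _ hmod).eq_of_lt_of_lt (truncVal_lt hp x m)
    (truncVal_lt hp y m)

theorem hasSum_top_digits {p : ℕ} (hp : 1 < p) (m : ℕ) :
    HasSum (fun r : ℕ => ((p - 1 : ℕ) : ℝ) / (p : ℝ) ^ (r + m + 1)) ((p : ℝ) ^ m)⁻¹ := by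
  have hp1 : (1 : ℝ) < p := by exact_mod_cast hp
  have hp0 : (p : ℝ) ≠ 0 := by positivity
  have hsub : (p : ℝ) - 1 ≠ 0 := by linarith
  have := (hasSum_geometric_of_lt_one (inv_nonneg.mpr p.cast_nonneg)
    (inv_lt_one_of_one_lt₀ hp1)).mul_left (((p : ℝ) - 1) / (p : ℝ) ^ (m + 1))
  rw [Nat.cast_sub hp.le]
  have hterm : ∀ r : ℕ, ((p : ℝ) - 1) / (p : ℝ) ^ (m + 1) * (p : ℝ)⁻¹ ^ r =
      ((p : ℝ) - (1 : ℕ)) / (p : ℝ) ^ (r + m + 1) := by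
    intro r
    rw [inv_pow, add_assoc, pow_add _ r, Nat.cast_one, div_mul_eq_mul_div, ← div_eq_mul_inv,
      div_div]
  have hval : ((p : ℝ) - 1) / (p : ℝ) ^ (m + 1) * (1 - (p : ℝ)⁻¹)⁻¹ = ((p : ℝ) ^ m)⁻¹ := by
    rw [show 1 - (p : ℝ)⁻¹ = (p - 1) / p by field_simp, pow_succ]
    field_simp
  simpa only [hterm, hval] using this

theorem summable_digits {p : ℕ} (hp : 1 < p) {f : ℕ → ℕ} (hf : ∀ r, f r < p) (m : ℕ) :
    Summable fun r : ℕ => (f (r + m) : ℝ) / (p : ℝ) ^ (r + m + 1) := by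
  refine (hasSum_top_digits hp m).summable.of_nonneg_of_le (fun r => by positivity) fun r => ?_
  gcongr
  exact Nat.le_sub_one_of_lt (hf _)

theorem tsum_digits_lt {p : ℕ} (hp : 1 < p) {f : ℕ → ℕ} (hf : ∀ r, f r < p) {m : ℕ}
    (h : ∃ r, m ≤ r ∧ f r ≠ p - 1) :
    ∑' r : ℕ, (f (r + m) : ℝ) / (p : ℝ) ^ (r + m + 1) < ((p : ℝ) ^ m)⁻¹ := by
  rw [← (hasSum_top_digits hp m).tsum_eq]
  obtain ⟨r, hr, hne⟩ := h
  obtain ⟨i, rfl⟩ := Nat.exists_eq_add_of_le' hr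
  refine Summable.tsum_lt_tsum (i := i) (fun j => ?_) ?_ (summable_digits hp hf m)
    (hasSum_top_digits hp m).summable
  · gcongr
    exact Nat.le_sub_one_of_lt (hf _)
  · gcongr
    exact lt_of_le_of_ne (Nat.le_sub_one_of_lt (hf _)) hne

/-- The shift differs from its truncation to `m` digits by less than `p ^ (-m)`. -/
theorem pshift_mem_Ico {p : ℕ} (hp : 1 < p) {x σ : ℝ} (hσ : 0 ≤ σ) {m : ℕ}
    (hx : ∀ r, m ≤ r → rdigit p x r = 0) :
    pshift p x σ ∈ Set.Ico ((digitNumer p (sdigit p x σ) m : ℝ) / (p : ℝ) ^ m)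
      ((digitNumer p (sdigit p x σ) m + 1 : ℝ) / (p : ℝ) ^ m) := by
  have hp0 : 0 < p := by lia
  have hd := sdigit_lt hp0 x σ
  have hsum := (summable_digits hp hd 0).sum_add_tsum_nat_add m
  simp only [add_zero] at hsum
  rw [sum_div_pow_eq_digitNumer hp0] at hsum
  have htail := tsum_digits_lt hp hd (exists_sdigit_ne hp hσ hx)
  have htail0 : 0 ≤ ∑' r : ℕ, (sdigit p x σ (r + m) : ℝ) / (p : ℝ) ^ (r + m + 1) :=
    tsum_nonneg fun r => by positivity
  have hN : (digitNumer p (sdigit p x σ) m + 1 : ℝ) / (p : ℝ) ^ m ≤ 1 := by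
    rw [div_le_one (by positivity)]
    exact_mod_cast digitNumer_lt_pow hd m
  have hN0 : (0 : ℝ) ≤ (digitNumer p (sdigit p x σ) m : ℝ) / (p : ℝ) ^ m := by positivity
  rw [add_div, one_div] at hN ⊢
  rw [pshift, ← hsum, Int.fract_eq_self.mpr ⟨by linarith, by linarith⟩]
  exact ⟨by linarith, by linarith⟩

theorem QSet.rdigit_eq_zero {p m : ℕ} (hp : 0 < p) {x : ℝ} (hx : QSet p m x) (r : ℕ)
    (hr : m ≤ r) : rdigit p x r = 0 := by
  obtain ⟨a, -, rfl⟩ := hx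
  obtain ⟨k, rfl⟩ := Nat.exists_eq_add_of_le hr
  have : (a : ℝ) / (p : ℝ) ^ m * (p : ℝ) ^ (m + k + 1) = ((a * p ^ k * p : ℕ) : ℝ) := by
    have : (p : ℝ) ≠ 0 := by positivity
    push_cast
    rw [pow_succ, pow_add]
    field_simp
  rw [rdigit, this, Int.floor_toNat, Nat.floor_natCast, Nat.mul_mod_left]

/-- Adding `δ ∈ [0, p ^ (-m))` to an element of `ℚ(p^m)` leaves its first `m` digits unchanged. -/
theorem digitNumer_rdigit_add {p m a : ℕ} (hp : 0 < p) (ha : a < p ^ m) {δ : ℝ}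
    (hδ : δ ∈ Set.Ico (0 : ℝ) (((p : ℝ) ^ m)⁻¹)) :
    digitNumer p (rdigit p ((a : ℝ) / (p : ℝ) ^ m + δ)) m = a := by
  have hpm : (0 : ℝ) < (p : ℝ) ^ m := by positivity
  have hδ1 : δ * (p : ℝ) ^ m < 1 := by
    have := mul_lt_mul_of_pos_right hδ.2 hpm
    rwa [inv_mul_cancel₀ hpm.ne'] at this
  have hδ0 : 0 ≤ δ * (p : ℝ) ^ m := mul_nonneg hδ.1 hpm.le
  have hmul : ((a : ℝ) / (p : ℝ) ^ m + δ) * (p : ℝ) ^ m = a + δ * (p : ℝ) ^ m := by field_simp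
  have ha' : (a : ℝ) + 1 ≤ (p : ℝ) ^ m := by exact_mod_cast ha
  rw [digitNumer_rdigit hp, hmul, Nat.floor_eq_iff (by positivity)]
  · exact ⟨by linarith, by linarith⟩
  · by_contra! h
    nlinarith

theorem QSet.simpShift_add {p m : ℕ} (hp : 0 < p) {σ : ℝ} (hσ : QSet p m σ) {δ : ℝ}
    (hδ : δ ∈ Set.Ico (0 : ℝ) (((p : ℝ) ^ m)⁻¹)) (x : ℝ) :
    simpShift p m x σ = simpShift p m x (σ + δ) := by
  obtain ⟨s, hs, rfl⟩ := hσ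
  have h0 := digitNumer_rdigit_add hp hs (Set.left_mem_Ico.mpr (hδ.1.trans_lt hδ.2))
  rw [add_zero] at h0
  have hdig := digitNumer_inj (rdigit_lt hp _) (rdigit_lt hp _) m
    (h0.trans (digitNumer_rdigit_add hp hs hδ).symm)
  refine Finset.sum_congr rfl fun r hr => ?_
  have hT : truncVal p ((s : ℝ) / (p : ℝ) ^ m) (r + 1) =
      truncVal p ((s : ℝ) / (p : ℝ) ^ m + δ) (r + 1) := by
    refine Finset.sum_congr rfl fun i hi => ?_
    rw [Finset.mem_range] at hr hi
    rw [hdig i (by lia)]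
  rw [sdigit, sdigit, hT]

theorem QSet.eq_of_truncVal_eq {p m : ℕ} (hp : 0 < p) {x y : ℝ} (hx : QSet p m x)
    (hy : QSet p m y) (h : truncVal p x m = truncVal p y m) : x = y := by
  have hdig := digitNumer_congr (p := p) m (rdigit_eq_of_truncVal_eq hp m h)
  obtain ⟨a, ha, rfl⟩ := hx
  obtain ⟨b, hb, rfl⟩ := hy
  have h0 : (0 : ℝ) ∈ Set.Ico (0 : ℝ) (((p : ℝ) ^ m)⁻¹) := ⟨le_rfl, by positivity⟩
  have hA := digitNumer_rdigit_add hp ha h0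
  have hB := digitNumer_rdigit_add hp hb h0
  rw [add_zero] at hA hB
  rw [hA.symm.trans (hdig.trans hB)]

/-- for distinct `h_n, h_k ∈ ℚ(p^m)`, the order of the exact shifts
`h ⊕_p (σ_m + δ)` agrees with the order of the simplified shifts `h ⊕_{p,m}^{simp} σ_m`. -/
theorem pshift_lt_iff_simpShift_lt
    (p : ℕ) (hp : p.Prime) (m : ℕ) (hm : 0 < m)
    (hn hk : ℝ) (hhn : QSet p m hn) (hhk : QSet p m hk) (hne : hn ≠ hk)
    (σm : ℝ) (hσ : QSet p m σm)
    (δ : ℝ) (hδ : δ ∈ Set.Ico (0 : ℝ) (((p : ℝ) ^ m)⁻¹)) :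
    pshift p hn (σm + δ) < pshift p hk (σm + δ) ↔
      simpShift p m hn σm < simpShift p m hk σm := by
  have hp1 := hp.one_lt
  have hp0 := hp.pos
  have hpm : (0 : ℝ) < (p : ℝ) ^ m := by positivity
  have hσ0 : 0 ≤ σm + δ := by
    obtain ⟨s, -, rfl⟩ := hσ
    exact add_nonneg (by positivity) hδ.1
  have hn_mem := pshift_mem_Ico hp1 hσ0 (hhn.rdigit_eq_zero hp0)
  have hk_mem := pshift_mem_Ico hp1 hσ0 (hhk.rdigit_eq_zero hp0)
  have hN : digitNumer p (sdigit p hn (σm + δ)) m ≠ digitNumer p (sdigit p hk (σm + δ)) m :=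
    fun h => hne <| hhn.eq_of_truncVal_eq hp0 hhk <| truncVal_eq_of_sdigit_eq hp0 m <|
      digitNumer_inj (sdigit_lt hp0 _ _) (sdigit_lt hp0 _ _) m h
  rw [hσ.simpShift_add hp0 hδ, hσ.simpShift_add hp0 hδ, simpShift, simpShift,
    sum_div_pow_eq_digitNumer hp0, sum_div_pow_eq_digitNumer hp0,
    div_lt_div_iff_of_pos_right hpm, Nat.cast_lt]
  have separated : ∀ {a b : ℕ} {u v : ℝ}, a < b → u < (a + 1 : ℝ) / (p : ℝ) ^ m →
      (b : ℝ) / (p : ℝ) ^ m ≤ v → u < v := by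
    intro a b u v hab hu hv
    refine hu.trans_le (le_trans ?_ hv)
    gcongr
    exact_mod_cast hab
  refine ⟨fun h => ?_, fun h => separated h hn_mem.2 hk_mem.1⟩
  by_contra hlt
  exact h.not_gt (separated (lt_of_le_of_ne (not_lt.mp hlt) hN.symm) hk_mem.2 hn_mem.1)
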